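/- arXiv:2410.06366 — 7 statements merged into one kernel-verified Lean document; each statement's English description precedes it below -/
import Mathlib

section
/- Under the forward Taylor-expansion hypotheses and assuming T·Δt ≤ L for a real constant L, there exists a constant C₂ ≥ 0 depending only on c₁, c₂, c₃, m, L such that the positions of the model forward trajectory and of the ground-truth trajectory satisfy ‖q^f_k − q^g_k‖ ≤ C₂·k²·Δt² for every 0 ≤ k ≤ T. -/
/-- A real sequence that starts at zero and grows by at most `b` in each of the first `T` steps
is bounded by `k * b` at every `k ≤ T`. -/
theorem le_nat_mul_of_step_le {e : ℕ → ℝ} {b : ℝ} {T : ℕ} (h0 : e 0 = 0)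
    (hstep : ∀ j < T, e (j + 1) ≤ e j + b) : ∀ k ≤ T, e k ≤ k * b := by
  intro k
  induction k with
  | zero => simp [h0]
  | succ k ih =>
    intro hk
    have h₁ := hstep k hk
    have h₂ := ih (by omega)
    push_cast
    linarith

theorem norm_sub_le_two_mul {V : Type*} [NormedAddCommGroup V] {x y : V} {b : ℝ}
    (hx : ‖x‖ ≤ b) (hy : ‖y‖ ≤ b) : ‖x - y‖ ≤ 2 * b := by
  linarith [norm_sub_le x y]

/-- Under the forward Taylor-expansion hypotheses and assuming `T·Δt ≤ L`, there is a
constant `C₂ ≥ 0` depending only on `c₁, c₂, c₃, m, L` such that the positions of the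
model forward trajectory and of the ground-truth trajectory satisfy
`‖q^f_k − q^g_k‖ ≤ C₂·k²·Δt²` for every `0 ≤ k ≤ T`. -/
theorem forward_position_error_bound
    (c₁ c₂ c₃ m L : ℝ) (hc₁ : 0 ≤ c₁) (hc₂ : 0 ≤ c₂) (hc₃ : 0 ≤ c₃) (hm : 0 < m) :
    ∃ C₂ : ℝ, 0 ≤ C₂ ∧
      ∀ (V : Type*) [NormedAddCommGroup V] [NormedSpace ℝ V]
        (Δt : ℝ) (T : ℕ) (qf pf af qg pg ag rf sf uf rg sg ug : ℕ → V),
        0 < Δt → 1 ≤ T → (T : ℝ) * Δt ≤ L →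
        (∀ j < T, qf (j+1) = qf j + (Δt/m) • pf j + (Δt^2/(2*m)) • af j + rf j) →
        (∀ j < T, pf (j+1) = pf j + Δt • af j + sf j) →
        (∀ j < T, af (j+1) = af j + uf j) →
        (∀ j < T, ‖rf j‖ ≤ c₃ * Δt^3) →
        (∀ j < T, ‖sf j‖ ≤ c₂ * Δt^2) →
        (∀ j < T, ‖uf j‖ ≤ c₁ * Δt) →
        (∀ j < T, qg (j+1) = qg j + (Δt/m) • pg j + (Δt^2/(2*m)) • ag j + rg j) →
        (∀ j < T, pg (j+1) = pg j + Δt • ag j + sg j) →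
        (∀ j < T, ag (j+1) = ag j + ug j) →
        (∀ j < T, ‖rg j‖ ≤ c₃ * Δt^3) →
        (∀ j < T, ‖sg j‖ ≤ c₂ * Δt^2) →
        (∀ j < T, ‖ug j‖ ≤ c₁ * Δt) →
        qf 0 = qg 0 → pf 0 = pg 0 → af 0 = ag 0 →
        ∀ k ≤ T, ‖qf k - qg k‖ ≤ C₂ * k^2 * Δt^2 := by
  have hM : 0 ≤ |L| := abs_nonneg L
  set M := |L|
  have hA : 0 ≤ 2 * c₁ * M := by positivity
  set A := 2 * c₁ * M
  have hB : 0 ≤ A + 2 * c₂ * M := by positivity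
  set B := A + 2 * c₂ * M
  have hC : 0 ≤ B / m + A / (2 * m) + 2 * c₃ * M := by positivity
  refine ⟨B / m + A / (2 * m) + 2 * c₃ * M, hC, ?_⟩
  intro V _ _ Δt T qf pf af qg pg ag rf sf uf rg sg ug hΔ hT hL
    hqf hpf haf hrf hsf huf hqg hpg hag hrg hsg hug hq0 hp0 ha0
  have htime : ∀ k ≤ T, (k : ℝ) * Δt ≤ M := fun k hk =>
    (mul_le_mul_of_nonneg_right (Nat.cast_le.mpr hk) hΔ.le).trans (hL.trans (le_abs_self L))
  have hΔM : Δt ≤ M := by simpa using htime 1 hT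
  have hacc : ∀ k ≤ T, ‖af k - ag k‖ ≤ A := by
    intro k hk
    have hk' := le_nat_mul_of_step_le (e := fun k => ‖af k - ag k‖) (b := 2 * (c₁ * Δt))
      (T := T) (by simp [ha0]) (fun j hj => by
        have heq : af (j + 1) - ag (j + 1) = (af j - ag j) + (uf j - ug j) := by
          rw [haf j hj, hag j hj]; abel
        simp only [heq]
        exact norm_add_le_of_le le_rfl (norm_sub_le_two_mul (huf j hj) (hug j hj))) k hk
    calc ‖af k - ag k‖ ≤ k * (2 * (c₁ * Δt)) := hk'
      _ = 2 * c₁ * (k * Δt) := by ring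
      _ ≤ 2 * c₁ * M := by gcongr; exact htime k hk
  have hmom : ∀ k ≤ T, ‖pf k - pg k‖ ≤ k * Δt * B := by
    intro k hk
    have hk' := le_nat_mul_of_step_le (e := fun k => ‖pf k - pg k‖)
      (b := Δt * A + 2 * (c₂ * Δt ^ 2)) (T := T) (by simp [hp0]) (fun j hj => by
        have heq : pf (j + 1) - pg (j + 1) =
            (pf j - pg j) + (Δt • (af j - ag j) + (sf j - sg j)) := by
          rw [hpf j hj, hpg j hj, smul_sub]; abel
        simp only [heq]
        refine norm_add_le_of_le le_rfl (norm_add_le_of_le ?_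
          (norm_sub_le_two_mul (hsf j hj) (hsg j hj)))
        rw [norm_smul, Real.norm_of_nonneg hΔ.le]
        gcongr
        exact hacc j hj.le) k hk
    calc ‖pf k - pg k‖ ≤ k * (Δt * A + 2 * (c₂ * Δt ^ 2)) := hk'
      _ = k * Δt * (A + 2 * c₂ * Δt) := by ring
      _ ≤ k * Δt * (A + 2 * c₂ * M) := by gcongr
  intro k hk
  have hk' := le_nat_mul_of_step_le (e := fun k => ‖qf k - qg k‖)
    (b := k * Δt ^ 2 * (B / m + A / (2 * m) + 2 * c₃ * M)) (T := k) (by simp [hq0]) (fun j hj => by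
      have hjT : j < T := hj.trans_le hk
      have hk1 : (1 : ℝ) ≤ k := by exact_mod_cast (by omega : 1 ≤ k)
      have heq : qf (j + 1) - qg (j + 1) = (qf j - qg j) + ((Δt / m) • (pf j - pg j) +
          (Δt ^ 2 / (2 * m)) • (af j - ag j) + (rf j - rg j)) := by
        rw [hqf j hjT, hqg j hjT, smul_sub, smul_sub]; abel
      simp only [heq]
      refine norm_add_le_of_le le_rfl ?_
      have hp : ‖(Δt / m) • (pf j - pg j)‖ ≤ k * Δt ^ 2 * (B / m) := by
        rw [norm_smul, Real.norm_of_nonneg (by positivity)]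
        calc Δt / m * ‖pf j - pg j‖ ≤ Δt / m * (j * Δt * B) := by
              gcongr; exact hmom j hjT.le
          _ ≤ Δt / m * (k * Δt * B) := by gcongr
          _ = k * Δt ^ 2 * (B / m) := by ring
      have ha : ‖(Δt ^ 2 / (2 * m)) • (af j - ag j)‖ ≤ k * Δt ^ 2 * (A / (2 * m)) := by
        rw [norm_smul, Real.norm_of_nonneg (by positivity)]
        calc Δt ^ 2 / (2 * m) * ‖af j - ag j‖ ≤ Δt ^ 2 / (2 * m) * A := by
              gcongr; exact hacc j hjT.le
          _ = 1 * Δt ^ 2 * (A / (2 * m)) := by ring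
          _ ≤ k * Δt ^ 2 * (A / (2 * m)) := by gcongr
      have hr : ‖rf j - rg j‖ ≤ k * Δt ^ 2 * (2 * c₃ * M) := by
        calc ‖rf j - rg j‖ ≤ 2 * (c₃ * Δt ^ 3) := norm_sub_le_two_mul (hrf j hjT) (hrg j hjT)
          _ = 1 * Δt ^ 2 * (2 * c₃ * Δt) := by ring
          _ ≤ k * Δt ^ 2 * (2 * c₃ * M) := by gcongr
      rw [mul_add, mul_add]
      exact norm_add_le_of_le (norm_add_le_of_le hp ha) hr) k le_rfl
  calc ‖qf k - qg k‖ ≤ k * (k * Δt ^ 2 * (B / m + A / (2 * m) + 2 * c₃ * M)) := hk'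
    _ = (B / m + A / (2 * m) + 2 * c₃ * M) * k ^ 2 * Δt ^ 2 := by ring
end

section
/- (Theorem 1, reconstruction-loss part.) Under the forward Taylor-expansion hypotheses and assuming T·Δt ≤ L for a real constant L, there exists a constant C ≥ 0 depending only on c₁, c₂, c₃, m, L such that the reconstruction loss satisfies Σ_{k=0}^{T} ( ‖q^f_k − q^g_k‖² + ‖p^f_k − p^g_k‖² ) ≤ C·T³·Δt²; i.e., the reconstruction loss is O(T³Δt²). -/
/-- A sequence vanishing at `0` whose increments have norm at most `K` grows at most linearly. -/
theorem norm_le_nat_mul_of_norm_sub_le {V : Type*} [SeminormedAddCommGroup V] {e : ℕ → V} {T : ℕ}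
    {K : ℝ} (h0 : e 0 = 0) (hstep : ∀ j < T, ‖e (j + 1) - e j‖ ≤ K) :
    ∀ k ≤ T, ‖e k‖ ≤ k * K := by
  intro k hk
  induction k with
  | zero => simp [h0]
  | succ k ih =>
    have h := norm_le_norm_add_norm_sub' (e (k + 1)) (e k)
    push_cast
    linarith [ih (by omega), hstep k (by omega)]

/-- Theorem 1, reconstruction-loss part: under the forward Taylor-expansion hypotheses
and assuming `T·Δt ≤ L`, there is a constant `C ≥ 0` depending only on
`c₁, c₂, c₃, m, L` such that the reconstruction loss satisfies
`Σ_{k=0}^{T} (‖q^f_k − q^g_k‖² + ‖p^f_k − p^g_k‖²) ≤ C·T³·Δt²`. -/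
theorem reconstruction_loss_bound
    (c₁ c₂ c₃ m L : ℝ) (hc₁ : 0 ≤ c₁) (hc₂ : 0 ≤ c₂) (hc₃ : 0 ≤ c₃) (hm : 0 < m) :
    ∃ C : ℝ, 0 ≤ C ∧
      ∀ (V : Type*) [NormedAddCommGroup V] [NormedSpace ℝ V]
        (Δt : ℝ) (T : ℕ) (qf pf af qg pg ag rf sf uf rg sg ug : ℕ → V),
        0 < Δt → 1 ≤ T → (T : ℝ) * Δt ≤ L →
        (∀ j < T, qf (j+1) = qf j + (Δt/m) • pf j + (Δt^2/(2*m)) • af j + rf j) →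
        (∀ j < T, pf (j+1) = pf j + Δt • af j + sf j) →
        (∀ j < T, af (j+1) = af j + uf j) →
        (∀ j < T, ‖rf j‖ ≤ c₃ * Δt^3) →
        (∀ j < T, ‖sf j‖ ≤ c₂ * Δt^2) →
        (∀ j < T, ‖uf j‖ ≤ c₁ * Δt) →
        (∀ j < T, qg (j+1) = qg j + (Δt/m) • pg j + (Δt^2/(2*m)) • ag j + rg j) →
        (∀ j < T, pg (j+1) = pg j + Δt • ag j + sg j) →
        (∀ j < T, ag (j+1) = ag j + ug j) →
        (∀ j < T, ‖rg j‖ ≤ c₃ * Δt^3) →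
        (∀ j < T, ‖sg j‖ ≤ c₂ * Δt^2) →
        (∀ j < T, ‖ug j‖ ≤ c₁ * Δt) →
        qf 0 = qg 0 → pf 0 = pg 0 → af 0 = ag 0 →
        ∑ k ∈ Finset.range (T + 1), (‖qf k - qg k‖^2 + ‖pf k - pg k‖^2)
          ≤ C * T^3 * Δt^2 := by
  set A : ℝ := 2 * c₁ * L
  set B : ℝ := A + 2 * c₂ * L with hB
  set D : ℝ := B * L / m + A * L / (2 * m) + 2 * c₃ * L ^ 2 with hD
  refine ⟨2 * (D ^ 2 + B ^ 2), by positivity, ?_⟩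
  intro V _ _ Δt T qf pf af qg pg ag rf sf uf rg sg ug hΔt hT hTL hqf hpf haf hrf hsf huf
    hqg hpg hag hrg hsg hug hq0 hp0 ha0
  have hT1 : (1 : ℝ) ≤ T := by exact_mod_cast hT
  have hΔtL : Δt ≤ L := by nlinarith
  have hL : 0 ≤ L := hΔt.le.trans hΔtL
  have hA0 : 0 ≤ A := by positivity
  have hB0 : 0 ≤ B := by positivity
  have hD0 : 0 ≤ D := by positivity
  have hkL : ∀ k ≤ T, (k : ℝ) * Δt ≤ L := fun k hk =>
    le_trans (by gcongr) hTL
  have ha : ∀ k ≤ T, ‖af k - ag k‖ ≤ A := by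
    intro k hk
    have h := norm_le_nat_mul_of_norm_sub_le (e := fun k => af k - ag k) (K := 2 * c₁ * Δt)
      (by simp [ha0]) (fun j hj => ?_) k hk
    · calc ‖af k - ag k‖ ≤ k * (2 * c₁ * Δt) := h
        _ = 2 * c₁ * (k * Δt) := by ring
        _ ≤ A := mul_le_mul_of_nonneg_left (hkL k hk) (by positivity)
    · have e : af (j + 1) - ag (j + 1) - (af j - ag j) = uf j - ug j := by
        rw [haf j hj, hag j hj]; abel
      simp only [e]
      linarith [norm_sub_le (uf j) (ug j), huf j hj, hug j hj]
  have hp : ∀ k ≤ T, ‖pf k - pg k‖ ≤ k * (B * Δt) := by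
    refine norm_le_nat_mul_of_norm_sub_le (e := fun k => pf k - pg k) (by simp [hp0])
      (fun j hj => ?_)
    have e : pf (j + 1) - pg (j + 1) - (pf j - pg j) = Δt • (af j - ag j) + (sf j - sg j) := by
      rw [hpf j hj, hpg j hj, smul_sub]; abel
    have hsmul : ‖Δt • (af j - ag j)‖ ≤ Δt * A := by
      rw [norm_smul, Real.norm_of_nonneg hΔt.le]
      gcongr
      exact ha j hj.le
    have hrem : c₂ * Δt ^ 2 ≤ c₂ * (L * Δt) := by rw [sq]; gcongr
    simp only [e]
    calc ‖Δt • (af j - ag j) + (sf j - sg j)‖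
        ≤ Δt * A + (c₂ * Δt ^ 2 + c₂ * Δt ^ 2) :=
          norm_add_le_of_le hsmul (norm_sub_le_of_le (hsf j hj) (hsg j hj))
      _ ≤ B * Δt := by rw [hB]; linarith
  have hpL : ∀ k ≤ T, ‖pf k - pg k‖ ≤ B * L := fun k hk =>
    calc ‖pf k - pg k‖ ≤ k * (B * Δt) := hp k hk
      _ = B * (k * Δt) := by ring
      _ ≤ B * L := mul_le_mul_of_nonneg_left (hkL k hk) hB0
  have hq : ∀ k ≤ T, ‖qf k - qg k‖ ≤ k * (D * Δt) := by
    refine norm_le_nat_mul_of_norm_sub_le (e := fun k => qf k - qg k) (by simp [hq0])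
      (fun j hj => ?_)
    have e : qf (j + 1) - qg (j + 1) - (qf j - qg j)
        = (Δt / m) • (pf j - pg j) + (Δt ^ 2 / (2 * m)) • (af j - ag j) + (rf j - rg j) := by
      rw [hqf j hj, hqg j hj, smul_sub, smul_sub]; abel
    have hsmul_p : ‖(Δt / m) • (pf j - pg j)‖ ≤ Δt / m * (B * L) := by
      rw [norm_smul, Real.norm_of_nonneg (by positivity)]
      gcongr
      exact hpL j hj.le
    have hsmul_a : ‖(Δt ^ 2 / (2 * m)) • (af j - ag j)‖ ≤ (L * Δt) / (2 * m) * A := by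
      rw [norm_smul, Real.norm_of_nonneg (by positivity), sq]
      gcongr
      exact ha j hj.le
    have hrem : c₃ * Δt ^ 3 ≤ c₃ * (L ^ 2 * Δt) := by rw [pow_succ]; gcongr
    simp only [e]
    calc ‖(Δt / m) • (pf j - pg j) + (Δt ^ 2 / (2 * m)) • (af j - ag j) + (rf j - rg j)‖
        ≤ Δt / m * (B * L) + (L * Δt) / (2 * m) * A + (c₃ * Δt ^ 3 + c₃ * Δt ^ 3) :=
          norm_add_le_of_le (norm_add_le_of_le hsmul_p hsmul_a)
            (norm_sub_le_of_le (hrf j hj) (hrg j hj))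
      _ ≤ Δt / m * (B * L) + (L * Δt) / (2 * m) * A
            + (c₃ * (L ^ 2 * Δt) + c₃ * (L ^ 2 * Δt)) := by gcongr
      _ = D * Δt := by rw [hD]; ring
  calc ∑ k ∈ Finset.range (T + 1), (‖qf k - qg k‖ ^ 2 + ‖pf k - pg k‖ ^ 2)
      ≤ ∑ _k ∈ Finset.range (T + 1), ((T * (D * Δt)) ^ 2 + (T * (B * Δt)) ^ 2) := by
        refine Finset.sum_le_sum fun k hk => ?_
        have hkT : k ≤ T := Finset.mem_range_succ_iff.mp hk
        gcongr
        · exact (hq k hkT).trans (by gcongr)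
        · exact (hp k hkT).trans (by gcongr)
    _ = (T + 1) * ((D ^ 2 + B ^ 2) * T ^ 2 * Δt ^ 2) := by
        rw [Finset.sum_const, Finset.card_range, nsmul_eq_mul]
        push_cast
        ring
    _ ≤ (2 * T) * ((D ^ 2 + B ^ 2) * T ^ 2 * Δt ^ 2) := by
        gcongr
        linarith
    _ = 2 * (D ^ 2 + B ^ 2) * T ^ 3 * Δt ^ 2 := by ring
end

section
/- Under the reverse Taylor-expansion hypotheses, the accelerations of the model reverse trajectory and of the model forward trajectory satisfy ‖a^r_k − a^f_k‖ ≤ 2·c₁·(T − k)·Δt for every 0 ≤ k ≤ T. -/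
/-- Under the reverse Taylor-expansion hypotheses, the accelerations of the model
reverse trajectory and of the model forward trajectory satisfy
`‖a^r_k − a^f_k‖ ≤ 2·c₁·(T − k)·Δt` for every `0 ≤ k ≤ T`. -/
theorem reverse_acceleration_error_bound
    {V : Type*} [NormedAddCommGroup V] [NormedSpace ℝ V]
    (m Δt : ℝ) (hm : 0 < m) (hΔt : 0 < Δt)
    (T : ℕ) (hT : 1 ≤ T)
    (c₁ c₂ c₃ : ℝ) (hc₁ : 0 ≤ c₁) (hc₂ : 0 ≤ c₂) (hc₃ : 0 ≤ c₃)
    (qf pf af qr pr ar : ℕ → V)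
    (rf sf uf rr sr ur : ℕ → V)
    (hqf : ∀ j < T, qf j = qf (j+1) - (Δt/m) • pf (j+1) + (Δt^2/(2*m)) • af (j+1) + rf j)
    (hpf : ∀ j < T, pf j = pf (j+1) - Δt • af (j+1) + sf j)
    (haf : ∀ j < T, af j = af (j+1) + uf j)
    (hrf : ∀ j < T, ‖rf j‖ ≤ c₃ * Δt^3)
    (hsf : ∀ j < T, ‖sf j‖ ≤ c₂ * Δt^2)
    (huf : ∀ j < T, ‖uf j‖ ≤ c₁ * Δt)
    (hqr : ∀ j < T, qr j = qr (j+1) + (Δt/m) • pr (j+1) + (Δt^2/(2*m)) • ar (j+1) + rr j)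
    (hpr : ∀ j < T, pr j = pr (j+1) + Δt • ar (j+1) + sr j)
    (har : ∀ j < T, ar j = ar (j+1) + ur j)
    (hrr : ∀ j < T, ‖rr j‖ ≤ c₃ * Δt^3)
    (hsr : ∀ j < T, ‖sr j‖ ≤ c₂ * Δt^2)
    (hur : ∀ j < T, ‖ur j‖ ≤ c₁ * Δt)
    (hqT : qr T = qf T) (hpT : pr T = -pf T) (haT : ar T = af T) :
    ∀ k ≤ T, ‖ar k - af k‖ ≤ 2 * c₁ * ((T : ℝ) - k) * Δt := by
  intro k hk
  induction hk using Nat.decreasingInduction with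
  | self => simp [haT]
  | of_succ j hj ih =>
    calc ‖ar j - af j‖ = ‖(ar (j+1) - af (j+1)) + (ur j - uf j)‖ := by
          rw [har j hj, haf j hj, add_sub_add_comm]
      _ ≤ ‖ar (j+1) - af (j+1)‖ + (‖ur j‖ + ‖uf j‖) :=
          (norm_add_le _ _).trans (by gcongr; exact norm_sub_le _ _)
      _ ≤ 2 * c₁ * ((T : ℝ) - (j+1 : ℕ)) * Δt + (c₁ * Δt + c₁ * Δt) := by
          gcongr
          exacts [hur j hj, huf j hj]
      _ = 2 * c₁ * ((T : ℝ) - j) * Δt := by push_cast; ring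
end

section
/- Under the reverse Taylor-expansion hypotheses, with C₂ := max{c₁, 2·c₂}, the (sign-reversed) momenta of the model reverse trajectory and the momenta of the model forward trajectory satisfy ‖p^r_k + p^f_k‖ ≤ C₂·(T − k)²·Δt² for every 0 ≤ k ≤ T. -/
/-- Two sequences with a common value at `T` whose backward steps have norm at most `ε` differ
by at most `2 * (T - k) * ε` at `k`. -/
theorem norm_sub_le_of_backward_steps {V : Type*} [SeminormedAddCommGroup V] {T : ℕ} {ε : ℝ}
    {x y u v : ℕ → V} (hx : ∀ j < T, x j = x (j + 1) + u j) (hy : ∀ j < T, y j = y (j + 1) + v j)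
    (hu : ∀ j < T, ‖u j‖ ≤ ε) (hv : ∀ j < T, ‖v j‖ ≤ ε) (hT : x T = y T) {k : ℕ} (hk : k ≤ T) :
    ‖x k - y k‖ ≤ 2 * ((T : ℝ) - k) * ε := by
  induction hk using Nat.decreasingInduction with
  | self => simp [hT]
  | of_succ k hk ih =>
    have hstep : x k - y k = (x (k + 1) - y (k + 1)) + (u k - v k) := by
      rw [hx k hk, hy k hk]
      abel
    have hadd := norm_add_le (x (k + 1) - y (k + 1)) (u k - v k)
    have hsub := norm_sub_le (u k) (v k)
    rw [hstep]
    push_cast at ih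
    linarith [hu k hk, hv k hk]

/-- Under the reverse Taylor-expansion hypotheses, with `C₂ := max c₁ (2·c₂)`, the
(sign-reversed) momenta of the model reverse trajectory and the momenta of the model
forward trajectory satisfy `‖p^r_k + p^f_k‖ ≤ C₂·(T − k)²·Δt²` for every `0 ≤ k ≤ T`. -/
theorem reverse_momentum_error_bound
    {V : Type*} [NormedAddCommGroup V] [NormedSpace ℝ V]
    (m Δt : ℝ) (hm : 0 < m) (hΔt : 0 < Δt)
    (T : ℕ) (hT : 1 ≤ T)
    (c₁ c₂ c₃ : ℝ) (hc₁ : 0 ≤ c₁) (hc₂ : 0 ≤ c₂) (hc₃ : 0 ≤ c₃)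
    (qf pf af qr pr ar : ℕ → V)
    (rf sf uf rr sr ur : ℕ → V)
    (hqf : ∀ j < T, qf j = qf (j+1) - (Δt/m) • pf (j+1) + (Δt^2/(2*m)) • af (j+1) + rf j)
    (hpf : ∀ j < T, pf j = pf (j+1) - Δt • af (j+1) + sf j)
    (haf : ∀ j < T, af j = af (j+1) + uf j)
    (hrf : ∀ j < T, ‖rf j‖ ≤ c₃ * Δt^3)
    (hsf : ∀ j < T, ‖sf j‖ ≤ c₂ * Δt^2)
    (huf : ∀ j < T, ‖uf j‖ ≤ c₁ * Δt)
    (hqr : ∀ j < T, qr j = qr (j+1) + (Δt/m) • pr (j+1) + (Δt^2/(2*m)) • ar (j+1) + rr j)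
    (hpr : ∀ j < T, pr j = pr (j+1) + Δt • ar (j+1) + sr j)
    (har : ∀ j < T, ar j = ar (j+1) + ur j)
    (hrr : ∀ j < T, ‖rr j‖ ≤ c₃ * Δt^3)
    (hsr : ∀ j < T, ‖sr j‖ ≤ c₂ * Δt^2)
    (hur : ∀ j < T, ‖ur j‖ ≤ c₁ * Δt)
    (hqT : qr T = qf T) (hpT : pr T = -pf T) (haT : ar T = af T) :
    ∀ k ≤ T, ‖pr k + pf k‖ ≤ max c₁ (2 * c₂) * ((T : ℝ) - k)^2 * Δt^2 := by
  intro k hk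
  induction hk using Nat.decreasingInduction with
  | self => simp [hpT]
  | of_succ k hk ih =>
    have hacc : ‖ar (k + 1) - af (k + 1)‖ ≤ 2 * ((T : ℝ) - (k + 1 : ℕ)) * (c₁ * Δt) :=
      norm_sub_le_of_backward_steps har haf hur huf haT hk
    have hstep : pr k + pf k =
        (pr (k + 1) + pf (k + 1)) + Δt • (ar (k + 1) - af (k + 1)) + (sr k + sf k) := by
      rw [hpr k hk, hpf k hk, smul_sub]
      abel
    have hrem : (0 : ℝ) ≤ (T : ℝ) - (k + 1 : ℕ) := sub_nonneg.2 (Nat.cast_le.2 hk)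
    set C := max c₁ (2 * c₂)
    have hC₁ : c₁ ≤ C := le_max_left _ _
    have hC₂ : 2 * c₂ ≤ C := le_max_right _ _
    calc ‖pr k + pf k‖
        ≤ ‖pr (k + 1) + pf (k + 1)‖ + Δt * ‖ar (k + 1) - af (k + 1)‖ + (‖sr k‖ + ‖sf k‖) := by
          rw [hstep, ← norm_smul_of_nonneg hΔt.le]
          exact norm_add₃_le.trans (by gcongr; exact norm_add_le _ _)
      _ ≤ C * ((T : ℝ) - (k + 1 : ℕ)) ^ 2 * Δt ^ 2
            + Δt * (2 * ((T : ℝ) - (k + 1 : ℕ)) * (c₁ * Δt)) + (c₂ * Δt ^ 2 + c₂ * Δt ^ 2) := by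
          gcongr
          exacts [hsr k hk, hsf k hk]
      _ = C * ((T : ℝ) - (k + 1 : ℕ)) ^ 2 * Δt ^ 2
            + 2 * ((T : ℝ) - (k + 1 : ℕ)) * c₁ * Δt ^ 2 + 2 * c₂ * Δt ^ 2 := by ring
      _ ≤ C * ((T : ℝ) - (k + 1 : ℕ)) ^ 2 * Δt ^ 2
            + 2 * ((T : ℝ) - (k + 1 : ℕ)) * C * Δt ^ 2 + C * Δt ^ 2 := by gcongr
      _ = C * ((T : ℝ) - k) ^ 2 * Δt ^ 2 := by
          push_cast
          ring
end

section
/- Under the reverse Taylor-expansion hypotheses, with C₂ := max{c₁, 2·c₂} and C₃ := max{C₂/(3m), c₁/(3m), 2·c₃}, the positions of the model reverse trajectory and of the model forward trajectory satisfy ‖q^r_k − q^f_k‖ ≤ C₃·(T − k)³·Δt³ for every 0 ≤ k ≤ T. -/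
/-- A bound that holds at `T` and propagates from `j + 1` to `j` holds at every `k ≤ T`. -/
theorem le_of_backward_step {α : Type*} [LE α] {T : ℕ} {f g : ℕ → α} (hT : f T ≤ g T)
    (hstep : ∀ j < T, f (j + 1) ≤ g (j + 1) → f j ≤ g j) : ∀ k ≤ T, f k ≤ g k :=
  fun _ hk => Nat.decreasingInduction (motive := fun j _ => f j ≤ g j) hstep hT hk

/-- Under the reverse Taylor-expansion hypotheses, with `C₂ := max c₁ (2·c₂)` and
`C₃ := max {C₂/(3m), c₁/(3m), 2·c₃}`, the positions of the model reverse trajectory and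
of the model forward trajectory satisfy `‖q^r_k − q^f_k‖ ≤ C₃·(T − k)³·Δt³` for every
`0 ≤ k ≤ T`. -/
theorem reverse_position_error_bound
    {V : Type*} [NormedAddCommGroup V] [NormedSpace ℝ V]
    (m Δt : ℝ) (hm : 0 < m) (hΔt : 0 < Δt)
    (T : ℕ) (hT : 1 ≤ T)
    (c₁ c₂ c₃ : ℝ) (hc₁ : 0 ≤ c₁) (hc₂ : 0 ≤ c₂) (hc₃ : 0 ≤ c₃)
    (qf pf af qr pr ar : ℕ → V)
    (rf sf uf rr sr ur : ℕ → V)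
    (hqf : ∀ j < T, qf j = qf (j+1) - (Δt/m) • pf (j+1) + (Δt^2/(2*m)) • af (j+1) + rf j)
    (hpf : ∀ j < T, pf j = pf (j+1) - Δt • af (j+1) + sf j)
    (haf : ∀ j < T, af j = af (j+1) + uf j)
    (hrf : ∀ j < T, ‖rf j‖ ≤ c₃ * Δt^3)
    (hsf : ∀ j < T, ‖sf j‖ ≤ c₂ * Δt^2)
    (huf : ∀ j < T, ‖uf j‖ ≤ c₁ * Δt)
    (hqr : ∀ j < T, qr j = qr (j+1) + (Δt/m) • pr (j+1) + (Δt^2/(2*m)) • ar (j+1) + rr j)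
    (hpr : ∀ j < T, pr j = pr (j+1) + Δt • ar (j+1) + sr j)
    (har : ∀ j < T, ar j = ar (j+1) + ur j)
    (hrr : ∀ j < T, ‖rr j‖ ≤ c₃ * Δt^3)
    (hsr : ∀ j < T, ‖sr j‖ ≤ c₂ * Δt^2)
    (hur : ∀ j < T, ‖ur j‖ ≤ c₁ * Δt)
    (hqT : qr T = qf T) (hpT : pr T = -pf T) (haT : ar T = af T) :
    ∀ k ≤ T, ‖qr k - qf k‖ ≤
      max (max (max c₁ (2 * c₂) / (3 * m)) (c₁ / (3 * m))) (2 * c₃)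
        * ((T : ℝ) - k)^3 * Δt^3 := by
  set C₂ := max c₁ (2 * c₂)
  set C₃ := max (max (C₂ / (3 * m)) (c₁ / (3 * m))) (2 * c₃)
  have hc₁C₂ : c₁ ≤ C₂ := le_max_left _ _
  have hc₂C₂ : 2 * c₂ ≤ C₂ := le_max_right _ _
  have hC₂C₃ : C₂ / m ≤ 3 * C₃ := by
    have h : C₂ / (3 * m) ≤ C₃ := (le_max_left _ _).trans (le_max_left _ _)
    calc C₂ / m = 3 * (C₂ / (3 * m)) := by field_simp
      _ ≤ 3 * C₃ := by gcongr
  have hc₁C₃ : c₁ / m ≤ 3 * C₃ := by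
    have h : c₁ / (3 * m) ≤ C₃ := (le_max_right _ _).trans (le_max_left _ _)
    calc c₁ / m = 3 * (c₁ / (3 * m)) := by field_simp
      _ ≤ 3 * C₃ := by gcongr
  have hc₃C₃ : 2 * c₃ ≤ C₃ := le_max_right _ _
  have hsteps : ∀ j < T, (0 : ℝ) ≤ T - (j + 1 : ℕ) := fun j hj =>
    sub_nonneg.2 (Nat.cast_le.2 hj)
  have ha : ∀ k ≤ T, ‖ar k - af k‖ ≤ 2 * c₁ * ((T : ℝ) - k) * Δt := by
    refine le_of_backward_step (by simp [haT]) fun j hj ih => ?_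
    have heq : ar j - af j = (ar (j+1) - af (j+1)) + (ur j - uf j) := by
      rw [har j hj, haf j hj]; abel
    calc ‖ar j - af j‖ ≤ ‖ar (j+1) - af (j+1)‖ + (‖ur j‖ + ‖uf j‖) := by
          rw [heq]; exact norm_add_le_of_le le_rfl (norm_sub_le _ _)
      _ ≤ 2 * c₁ * ((T : ℝ) - (j + 1 : ℕ)) * Δt + (c₁ * Δt + c₁ * Δt) :=
          add_le_add ih (add_le_add (hur j hj) (huf j hj))
      _ = 2 * c₁ * ((T : ℝ) - j) * Δt := by push_cast; ring
  have hp : ∀ k ≤ T, ‖pr k + pf k‖ ≤ C₂ * ((T : ℝ) - k)^2 * Δt^2 := by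
    refine le_of_backward_step (by simp [hpT]) fun j hj ih => ?_
    have heq : pr j + pf j =
        (pr (j+1) + pf (j+1)) + Δt • (ar (j+1) - af (j+1)) + (sr j + sf j) := by
      rw [hpr j hj, hpf j hj]; module
    have hn := hsteps j hj
    have haj := ha (j+1) hj
    set n : ℝ := (T : ℝ) - (j + 1 : ℕ) with hn_def
    have hjn : (T : ℝ) - j = n + 1 := by rw [hn_def]; push_cast; ring
    rw [hjn]
    calc ‖pr j + pf j‖
        ≤ ‖pr (j+1) + pf (j+1)‖ + Δt * ‖ar (j+1) - af (j+1)‖ + (‖sr j‖ + ‖sf j‖) := by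
          rw [heq]
          exact norm_add_le_of_le (norm_add_le_of_le le_rfl
            (norm_smul_of_nonneg hΔt.le _).le) (norm_add_le _ _)
      _ ≤ C₂ * n^2 * Δt^2 + Δt * (2 * c₁ * n * Δt) + (c₂ * Δt^2 + c₂ * Δt^2) := by
          gcongr
          exacts [hsr j hj, hsf j hj]
      _ = (C₂ * n^2 + 2 * (c₁ * n) + 2 * c₂) * Δt^2 := by ring
      _ ≤ (C₂ * n^2 + 2 * (C₂ * n) + C₂) * Δt^2 := by gcongr
      _ = C₂ * (n + 1)^2 * Δt^2 := by ring
  refine le_of_backward_step (by simp [hqT]) fun j hj ih => ?_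
  have heq : qr j - qf j = (qr (j+1) - qf (j+1)) + (Δt/m) • (pr (j+1) + pf (j+1))
      + (Δt^2/(2*m)) • (ar (j+1) - af (j+1)) + (rr j - rf j) := by
    rw [hqr j hj, hqf j hj]; module
  have hn := hsteps j hj
  have haj := ha (j+1) hj
  have hpj := hp (j+1) hj
  set n : ℝ := (T : ℝ) - (j + 1 : ℕ) with hn_def
  have hjn : (T : ℝ) - j = n + 1 := by rw [hn_def]; push_cast; ring
  rw [hjn]
  calc ‖qr j - qf j‖
      ≤ ‖qr (j+1) - qf (j+1)‖ + (Δt/m) * ‖pr (j+1) + pf (j+1)‖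
        + (Δt^2/(2*m)) * ‖ar (j+1) - af (j+1)‖ + (‖rr j‖ + ‖rf j‖) := by
        rw [heq]
        exact norm_add_le_of_le (norm_add_le_of_le (norm_add_le_of_le le_rfl
          (norm_smul_of_nonneg (by positivity) _).le)
          (norm_smul_of_nonneg (by positivity) _).le) (norm_sub_le _ _)
    _ ≤ C₃ * n^3 * Δt^3 + (Δt/m) * (C₂ * n^2 * Δt^2)
        + (Δt^2/(2*m)) * (2 * c₁ * n * Δt) + (c₃ * Δt^3 + c₃ * Δt^3) := by
        gcongr
        exacts [hrr j hj, hrf j hj]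
    _ = (C₃ * n^3 + C₂ / m * n^2 + c₁ / m * n + 2 * c₃) * Δt^3 := by
        field_simp; ring
    _ ≤ (C₃ * n^3 + 3 * C₃ * n^2 + 3 * C₃ * n + C₃) * Δt^3 := by gcongr
    _ = C₃ * (n + 1)^3 * Δt^3 := by ring
end

section
/- (Theorem 1, time-reversal-loss part.) Under the reverse Taylor-expansion hypotheses and assuming T·Δt ≤ L for a real constant L, there exists a constant C ≥ 0 depending only on c₁, c₂, c₃, m, L such that the time-reversal loss satisfies Σ_{k=0}^{T} ( ‖q^r_k − q^f_k‖² + ‖p^r_k + p^f_k‖² ) ≤ C·T⁵·Δt⁴; i.e., the time-reversal loss is O(T⁵Δt⁴). -/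
/-- A sequence that vanishes at `T` and moves by at most `b` at each step before `T` is bounded
by `T * b` up to time `T`. -/
lemma norm_le_mul_of_norm_sub_succ_le {V : Type*} [SeminormedAddCommGroup V] {x : ℕ → V} {T : ℕ}
    {b : ℝ} (hb : 0 ≤ b) (hT : x T = 0) (h : ∀ j < T, ‖x j - x (j + 1)‖ ≤ b) {k : ℕ}
    (hk : k ≤ T) : ‖x k‖ ≤ T * b := by
  have hd := dist_le_Ico_sum_of_dist_le (f := x) hk (d := fun _ => b)
    (fun _ hj => by rw [dist_eq_norm]; exact h _ hj)
  rw [hT, dist_zero_right, Finset.sum_const, Nat.card_Ico, nsmul_eq_mul] at hd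
  refine hd.trans ?_
  gcongr
  exact Nat.sub_le T k

/-- Theorem 1, time-reversal-loss part: under the reverse Taylor-expansion hypotheses
and assuming `T·Δt ≤ L`, there is a constant `C ≥ 0` depending only on
`c₁, c₂, c₃, m, L` such that the time-reversal loss satisfies
`Σ_{k=0}^{T} (‖q^r_k − q^f_k‖² + ‖p^r_k + p^f_k‖²) ≤ C·T⁵·Δt⁴`. -/
theorem time_reversal_loss_bound
    (c₁ c₂ c₃ m L : ℝ) (hc₁ : 0 ≤ c₁) (hc₂ : 0 ≤ c₂) (hc₃ : 0 ≤ c₃) (hm : 0 < m) :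
    ∃ C : ℝ, 0 ≤ C ∧
      ∀ (V : Type*) [NormedAddCommGroup V] [NormedSpace ℝ V]
        (Δt : ℝ) (T : ℕ) (qf pf af qr pr ar rf sf uf rr sr ur : ℕ → V),
        0 < Δt → 1 ≤ T → (T : ℝ) * Δt ≤ L →
        (∀ j < T, qf j = qf (j+1) - (Δt/m) • pf (j+1) + (Δt^2/(2*m)) • af (j+1) + rf j) →
        (∀ j < T, pf j = pf (j+1) - Δt • af (j+1) + sf j) →
        (∀ j < T, af j = af (j+1) + uf j) →
        (∀ j < T, ‖rf j‖ ≤ c₃ * Δt^3) →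
        (∀ j < T, ‖sf j‖ ≤ c₂ * Δt^2) →
        (∀ j < T, ‖uf j‖ ≤ c₁ * Δt) →
        (∀ j < T, qr j = qr (j+1) + (Δt/m) • pr (j+1) + (Δt^2/(2*m)) • ar (j+1) + rr j) →
        (∀ j < T, pr j = pr (j+1) + Δt • ar (j+1) + sr j) →
        (∀ j < T, ar j = ar (j+1) + ur j) →
        (∀ j < T, ‖rr j‖ ≤ c₃ * Δt^3) →
        (∀ j < T, ‖sr j‖ ≤ c₂ * Δt^2) →
        (∀ j < T, ‖ur j‖ ≤ c₁ * Δt) →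
        qr T = qf T → pr T = -pf T → ar T = af T →
        ∑ k ∈ Finset.range (T + 1), (‖qr k - qf k‖^2 + ‖pr k + pf k‖^2)
          ≤ C * T^5 * Δt^4 := by
  set B : ℝ := 2 * (c₁ + c₂) with hB
  set D : ℝ := B / m + c₁ / m + 2 * c₃ with hD
  have hB0 : 0 ≤ B := by positivity
  have hD0 : 0 ≤ D := by positivity
  refine ⟨2 * ((L * D) ^ 2 + B ^ 2), by positivity, ?_⟩
  intro V _ _ Δt T qf pf af qr pr ar rf sf uf rr sr ur hΔt hT hL hqf hpf haf hrf hsf huf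
    hqr hpr har hrr hsr hur hqT hpT haT
  have hT1 : (1 : ℝ) ≤ T := by exact_mod_cast hT
  have hA : ∀ k ≤ T, ‖ar k - af k‖ ≤ T * (2 * c₁ * Δt) := fun k hk =>
    norm_le_mul_of_norm_sub_succ_le (x := fun k => ar k - af k) (by positivity)
      (by simp [haT]) (fun j hj => by
        have e : ar j - af j - (ar (j + 1) - af (j + 1)) = ur j - uf j := by
          rw [har j hj, haf j hj]; abel
        rw [e]
        linarith [norm_sub_le (ur j) (uf j), hur j hj, huf j hj]) hk
  have hP : ∀ k ≤ T, ‖pr k + pf k‖ ≤ T * (B * T * Δt ^ 2) := fun k hk =>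
    norm_le_mul_of_norm_sub_succ_le (x := fun k => pr k + pf k) (by positivity)
      (by simp [hpT]) (fun j hj => by
        have e : pr j + pf j - (pr (j + 1) + pf (j + 1))
            = Δt • (ar (j + 1) - af (j + 1)) + (sr j + sf j) := by
          rw [hpr j hj, hpf j hj]; module
        rw [e]
        calc _ ≤ ‖Δt • (ar (j + 1) - af (j + 1))‖ + (‖sr j‖ + ‖sf j‖) :=
              norm_add_le_of_le le_rfl (norm_add_le _ _)
          _ ≤ Δt * (T * (2 * c₁ * Δt)) + (c₂ * Δt ^ 2 + c₂ * Δt ^ 2) := by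
              rw [norm_smul, Real.norm_of_nonneg hΔt.le]
              gcongr
              exacts [hA _ hj, hsr j hj, hsf j hj]
          _ = 2 * c₁ * T * Δt ^ 2 + 2 * c₂ * 1 * Δt ^ 2 := by ring
          _ ≤ 2 * c₁ * T * Δt ^ 2 + 2 * c₂ * T * Δt ^ 2 := by gcongr
          _ = B * T * Δt ^ 2 := by rw [hB]; ring) hk
  have hQ : ∀ k ≤ T, ‖qr k - qf k‖ ≤ T * (D * T ^ 2 * Δt ^ 3) := fun k hk =>
    norm_le_mul_of_norm_sub_succ_le (x := fun k => qr k - qf k) (by positivity)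
      (by simp [hqT]) (fun j hj => by
        have e : qr j - qf j - (qr (j + 1) - qf (j + 1))
            = (Δt / m) • (pr (j + 1) + pf (j + 1))
              + (Δt ^ 2 / (2 * m)) • (ar (j + 1) - af (j + 1)) + (rr j - rf j) := by
          rw [hqr j hj, hqf j hj]; module
        rw [e]
        calc _ ≤ ‖(Δt / m) • (pr (j + 1) + pf (j + 1))‖
                + ‖(Δt ^ 2 / (2 * m)) • (ar (j + 1) - af (j + 1))‖ + (‖rr j‖ + ‖rf j‖) :=
              norm_add_le_of_le (norm_add_le _ _) (norm_sub_le _ _)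
          _ ≤ Δt / m * (T * (B * T * Δt ^ 2)) + Δt ^ 2 / (2 * m) * (T * (2 * c₁ * Δt))
                + (c₃ * Δt ^ 3 + c₃ * Δt ^ 3) := by
              rw [norm_smul, norm_smul, Real.norm_of_nonneg (by positivity : 0 ≤ Δt / m),
                Real.norm_of_nonneg (by positivity : 0 ≤ Δt ^ 2 / (2 * m))]
              gcongr
              exacts [hP _ hj, hA _ hj, hrr j hj, hrf j hj]
          _ = B / m * T ^ 2 * Δt ^ 3 + c₁ / m * T * Δt ^ 3 + 2 * c₃ * 1 * Δt ^ 3 := by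
              field_simp
              ring
          _ ≤ B / m * T ^ 2 * Δt ^ 3 + c₁ / m * T ^ 2 * Δt ^ 3 + 2 * c₃ * T ^ 2 * Δt ^ 3 := by
              gcongr
              · exact le_self_pow₀ hT1 two_ne_zero
              · exact one_le_pow₀ hT1
          _ = D * T ^ 2 * Δt ^ 3 := by rw [hD]; ring) hk
  calc _ ≤ ∑ _k ∈ Finset.range (T + 1), ((L * D) ^ 2 + B ^ 2) * T ^ 4 * Δt ^ 4 := by
        refine Finset.sum_le_sum fun k hk => ?_
        have hkT : k ≤ T := Finset.mem_range_succ_iff.mp hk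
        have hQL : ‖qr k - qf k‖ ≤ L * D * (T ^ 2 * Δt ^ 2) :=
          calc _ ≤ T * (D * T ^ 2 * Δt ^ 3) := hQ k hkT
            _ = T * Δt * D * (T ^ 2 * Δt ^ 2) := by ring
            _ ≤ _ := by gcongr
        calc _ ≤ (L * D * (T ^ 2 * Δt ^ 2)) ^ 2 + (T * (B * T * Δt ^ 2)) ^ 2 := by
              gcongr
              exact hP k hkT
          _ = _ := by ring
    _ = (T + 1) * (((L * D) ^ 2 + B ^ 2) * T ^ 4 * Δt ^ 4) := by simp
    _ ≤ (T + T) * (((L * D) ^ 2 + B ^ 2) * T ^ 4 * Δt ^ 4) := by gcongr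
    _ = _ := by ring
end

section
/- (Energy dissipation of the damped spring system.) For the n-body damped spring system, the energy along any solution satisfies d/dt [ E(q(t), p(t)) ] = −(γ/m²)·Σ_i ‖p_i(t)‖² for all t ∈ ℝ; in particular, if γ ≥ 0 then t ↦ E(q(t), p(t)) is nonincreasing, so the system is non-conservative whenever γ > 0 and some momentum is nonzero. -/
/-- Summation by parts for the Laplacian of a symmetric relation. -/
theorem sum_sum_inner_sub_sub_of_symmetric {ι E : Type*} [Fintype ι]
    [NormedAddCommGroup E] [InnerProductSpace ℝ E]
    {A : ι → ι → Prop} [DecidableRel A] (hA : Symmetric A) (x y : ι → E) :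
    ∑ i, ∑ j ∈ Finset.univ.filter (fun j => A i j), inner ℝ (x i - x j) (y i - y j) =
      2 * ∑ i, inner ℝ (y i) (∑ j ∈ Finset.univ.filter (fun j => A i j), (x i - x j)) := by
  have hswap : ∑ i, ∑ j ∈ Finset.univ.filter (fun j => A i j), inner ℝ (y j) (x i - x j) =
      -∑ i, ∑ j ∈ Finset.univ.filter (fun j => A i j), inner ℝ (y i) (x i - x j) := by
    simp only [Finset.sum_filter]
    rw [Finset.sum_comm, ← Finset.sum_neg_distrib]
    refine Finset.sum_congr rfl fun i _ => ?_
    rw [← Finset.sum_neg_distrib]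
    refine Finset.sum_congr rfl fun j _ => ?_
    rw [← neg_sub (x i) (x j), inner_neg_right]
    by_cases h : A i j
    · rw [if_pos h, if_pos (hA h)]
    · rw [if_neg h, if_neg fun h' => h (hA h'), neg_zero]
  simp only [inner_sum]
  simp only [real_inner_comm (y _ - y _), inner_sub_left (y _) (y _), Finset.sum_sub_distrib,
    hswap]
  ring

/-- Energy dissipation of the n-body damped spring system: along any solution of
`qᵢ' = pᵢ/m`, `pᵢ' = −k·Σ_{j : A i j}(qᵢ − qⱼ) − (γ/m)·pᵢ`, the energy
`E(q,p) = Σᵢ ‖pᵢ‖²/(2m) + (k/4)·Σᵢ Σ_{j : A i j} ‖qᵢ − qⱼ‖²` satisfies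
`d/dt E(q(t), p(t)) = −(γ/m²)·Σᵢ ‖pᵢ(t)‖²`; in particular, if `γ ≥ 0` then the
energy is nonincreasing. -/
theorem damped_spring_energy_dissipation
    (N d : ℕ) (hN : 1 ≤ N)
    (A : Fin N → Fin N → Prop) [DecidableRel A] (hA : Symmetric A)
    (m k γ : ℝ) (hm : 0 < m)
    (q p : Fin N → ℝ → EuclideanSpace ℝ (Fin d))
    (hq : ∀ i t, HasDerivAt (q i) ((1 / m) • p i t) t)
    (hp : ∀ i t, HasDerivAt (p i)
      (-(k • ∑ j ∈ Finset.univ.filter (fun j => A i j), (q i t - q j t))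
        - (γ / m) • p i t) t) :
    (∀ t : ℝ, HasDerivAt
      (fun t => (∑ i, ‖p i t‖ ^ 2 / (2 * m)) +
        (k / 4) * ∑ i, ∑ j ∈ Finset.univ.filter (fun j => A i j), ‖q i t - q j t‖ ^ 2)
      (-(γ / m ^ 2) * ∑ i, ‖p i t‖ ^ 2) t) ∧
    (0 ≤ γ → Antitone
      (fun t => (∑ i, ‖p i t‖ ^ 2 / (2 * m)) +
        (k / 4) * ∑ i, ∑ j ∈ Finset.univ.filter (fun j => A i j), ‖q i t - q j t‖ ^ 2)) := by
  have hE : ∀ t : ℝ, HasDerivAt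
      (fun t => (∑ i, ‖p i t‖ ^ 2 / (2 * m)) +
        (k / 4) * ∑ i, ∑ j ∈ Finset.univ.filter (fun j => A i j), ‖q i t - q j t‖ ^ 2)
      (-(γ / m ^ 2) * ∑ i, ‖p i t‖ ^ 2) t := by
    intro t
    have hkin := HasDerivAt.fun_sum (u := Finset.univ)
      fun i _ => ((hp i t).norm_sq).div_const (2 * m)
    have hpot := HasDerivAt.fun_sum (u := Finset.univ) fun i _ =>
      HasDerivAt.fun_sum (u := Finset.univ.filter (fun j => A i j))
        fun j _ => ((hq i t).sub (hq j t)).norm_sq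
    refine (hkin.add (hpot.const_mul (k / 4))).congr_deriv ?_
    simp only [Pi.sub_apply, ← Finset.mul_sum]
    rw [sum_sum_inner_sub_sub_of_symmetric hA (fun i => q i t) (fun i => (1 / m) • p i t)]
    simp only [Finset.mul_sum, ← Finset.sum_add_distrib]
    refine Finset.sum_congr rfl fun i _ => ?_
    simp only [inner_sub_right, inner_neg_right, real_inner_smul_right, real_inner_smul_left,
      real_inner_self_eq_norm_sq]
    field_simp
    ring
  refine ⟨hE, fun hγ => antitone_of_hasDerivAt_nonpos hE fun t => ?_⟩
  rw [Pi.zero_apply, neg_mul, neg_nonpos]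
  positivity
end
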